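/- arXiv:math/0404041 — 4 statements merged into one kernel-verified Lean document; each statement's English description precedes it below -/
import Mathlib

section
/- Suppose p ∈ Δ satisfies H(p) > 0 and π(p) = p, p lies in a proper face of Δ (p_k = 0 for some k), and p is a linear non-maximum: there exist indices k and j with p_k = 0, p_j > 0, and N_k(p) > N_j(p). Then P(V(n) → p as n → ∞) = 0. -/
open MeasureTheory Filter Finset

namespace VRRW

noncomputable def simplex (d : ℕ) : Set (Fin d → ℝ) :=
  {v | (∀ i, 0 ≤ v i) ∧ ∑ i, v i = 1}

noncomputable def Nvec {d : ℕ} (R : Matrix (Fin d) (Fin d) ℝ) (v : Fin d → ℝ) (i : Fin d) : ℝ :=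
  ∑ j, R i j * v j

noncomputable def Hfun {d : ℕ} (R : Matrix (Fin d) (Fin d) ℝ) (v : Fin d → ℝ) : ℝ :=
  ∑ i, ∑ j, R i j * v i * v j

noncomputable def piVec {d : ℕ} (R : Matrix (Fin d) (Fin d) ℝ) (v : Fin d → ℝ) : Fin d → ℝ :=
  fun i => v i * Nvec R v i / Hfun R v

noncomputable def Mmat {d : ℕ} (R : Matrix (Fin d) (Fin d) ℝ) (v : Fin d → ℝ) :
    Matrix (Fin d) (Fin d) ℝ :=
  fun i j => R i j * v j / Nvec R v i

noncomputable def critSet {d : ℕ} (R : Matrix (Fin d) (Fin d) ℝ) : Set (Fin d → ℝ) :=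
  {v | v ∈ simplex d ∧ 0 < Hfun R v ∧ piVec R v = v}

noncomputable def degenSet {d : ℕ} (R : Matrix (Fin d) (Fin d) ℝ) : Set (Fin d → ℝ) :=
  {v | v ∈ simplex d ∧ ((∃ i, Nvec R v i = 0) ∨ ∃ i j, ∀ k, 1 ≤ k → (Mmat R v ^ k) i j = 0)}

/-- `S_i(n)`: one plus the number of visits to state `i` strictly after time `d`, up to time `n`. -/
noncomputable def visits {d : ℕ} {Ω : Type*} (Y : ℕ → Ω → Fin d) (n : ℕ) (ω : Ω) (i : Fin d) : ℝ :=
  1 + (((Finset.Ioc d n).filter fun m => Y m ω = i).card : ℝ)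

/-- `V(n) = S(n)/n`, the fractional occupation vector. -/
noncomputable def occup {d : ℕ} {Ω : Type*} (Y : ℕ → Ω → Fin d) (n : ℕ) (ω : Ω) : Fin d → ℝ :=
  fun i => visits Y n ω i / n

/-- The natural filtration `F_n = σ(Y_d, …, Y_n)`. -/
def natFilt {d : ℕ} {Ω : Type*} (Y : ℕ → Ω → Fin d) (n : ℕ) : MeasurableSpace Ω :=
  ⨆ m ∈ Finset.Icc d n, MeasurableSpace.comap (Y m) ⊤

/-- The defining properties of the vertex-reinforced random walk driven by `R`:
measurability, start `Y_d = 1` (state `1` is encoded as index `0` of `Fin d`), and the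
reinforced transition probabilities, expressed via conditional expectation of indicators. -/
def IsVRRW {d : ℕ} {Ω : Type*} [MeasurableSpace Ω] (μ : Measure Ω)
    (R : Matrix (Fin d) (Fin d) ℝ) (Y : ℕ → Ω → Fin d) : Prop :=
  (∀ n, Measurable (Y n)) ∧
  (∀ ω, (Y d ω : ℕ) = 0) ∧
  (∀ n, d ≤ n → ∀ j : Fin d,
    (μ[(fun ω => if Y (n + 1) ω = j then (1 : ℝ) else 0) | natFilt Y n])
      =ᵐ[μ] fun ω => R (Y n ω) j * visits Y n ω j / ∑ i, R (Y n ω) i * visits Y n ω i)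

/-- Euclidean distance from a point to a set: `inf {|x − y| : y ∈ A}`. -/
noncomputable def distToSet {d : ℕ} (x : Fin d → ℝ) (A : Set (Fin d → ℝ)) : ℝ :=
  sInf ((fun y => Real.sqrt (∑ i, (x i - y i) ^ 2)) '' A)

end VRRW

open VRRW MeasureTheory Filter

namespace VRRW

/-- The number of visits to `k` strictly after time `d`, up to time `n`. -/
noncomputable def visitCount {d : ℕ} {Ω : Type*} (Y : ℕ → Ω → Fin d) (k : Fin d) (n : ℕ)
    (ω : Ω) : ℕ :=
  ((Finset.Ioc d n).filter fun m => Y m ω = k).card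

/-- The conditional probability of stepping to `k` at time `n + 1`, divided by `S_k(n)`. -/
noncomputable def hazard {d : ℕ} {Ω : Type*} (R : Matrix (Fin d) (Fin d) ℝ) (Y : ℕ → Ω → Fin d)
    (k : Fin d) (n : ℕ) (ω : Ω) : ℝ :=
  R (Y n ω) k / ∑ i, R (Y n ω) i * visits Y n ω i

/-- The product `∏_{1 ≤ m ≤ s} (1 - 1 / (2 m))`, which is of order `1 / √s`. -/
noncomputable def halfProd (s : ℕ) : ℝ :=
  ∏ m ∈ Finset.range s, (1 - 1 / (2 * ((m : ℝ) + 1)))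

/-- A nonnegative process with nonincreasing expectation, of order
`exp (½ ∑ hazard) / √(S_k(n))`. -/
noncomputable def lyapunov {d : ℕ} {Ω : Type*} (R : Matrix (Fin d) (Fin d) ℝ) (Y : ℕ → Ω → Fin d)
    (k : Fin d) (n : ℕ) (ω : Ω) : ℝ :=
  halfProd (visitCount Y k n ω) * Real.exp (1 / 2 * ∑ m ∈ Finset.Ico d n, hazard R Y k m ω)

lemma halfProd_succ (s : ℕ) : halfProd (s + 1) = halfProd s * (1 - 1 / (2 * ((s : ℝ) + 1))) := by
  simp [halfProd, Finset.prod_range_succ]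

lemma halfProd_factor_mem (s : ℕ) :
    0 < 1 - 1 / (2 * ((s : ℝ) + 1)) ∧ 1 - 1 / (2 * ((s : ℝ) + 1)) ≤ 1 := by
  have h0 : (0 : ℝ) < 2 * ((s : ℝ) + 1) := by positivity
  have h1 : 1 / (2 * ((s : ℝ) + 1)) < 1 := by
    rw [div_lt_one h0]
    have : (0 : ℝ) ≤ s := by positivity
    linarith
  exact ⟨by linarith, by linarith [div_pos one_pos h0]⟩

lemma halfProd_pos (s : ℕ) : 0 < halfProd s :=
  Finset.prod_pos fun m _ => (halfProd_factor_mem m).1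

lemma halfProd_le_one (s : ℕ) : halfProd s ≤ 1 :=
  Finset.prod_le_one (fun m _ => (halfProd_factor_mem m).1.le) fun m _ => (halfProd_factor_mem m).2

lemma one_le_halfProd_sq_mul (s : ℕ) : 1 ≤ halfProd s ^ 2 * (4 * s + 1) := by
  induction s with
  | zero => simp [halfProd]
  | succ s ih =>
    refine ih.trans ?_
    rw [halfProd_succ, mul_pow, mul_assoc]
    refine mul_le_mul_of_nonneg_left ?_ (sq_nonneg _)
    have h0 : (0 : ℝ) < (s : ℝ) + 1 := by positivity
    have key : (1 - 1 / (2 * ((s : ℝ) + 1))) ^ 2 * (4 * ((s + 1 : ℕ) : ℝ) + 1) =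
        4 * s + 1 + 1 / (4 * ((s : ℝ) + 1) ^ 2) := by
      push_cast
      field_simp
      ring
    rw [key]
    have : 0 < 1 / (4 * ((s : ℝ) + 1) ^ 2) := by positivity
    linarith

lemma exp_neg_half_log_le_halfProd {s n : ℕ} (h : s + 1 ≤ n) :
    1 / 2 * Real.exp (-(1 / 2 * Real.log n)) ≤ halfProd s := by
  have hn : (0 : ℝ) < n := by exact_mod_cast (by omega : 0 < n)
  have hE : Real.exp (-(1 / 2 * Real.log n)) ^ 2 * n = 1 := by
    rw [← Real.exp_nat_mul]
    have : ((2 : ℕ) : ℝ) * -(1 / 2 * Real.log n) = -Real.log n := by push_cast; ring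
    rw [this, Real.exp_neg, Real.exp_log hn, inv_mul_cancel₀ hn.ne']
  have hsn : (s : ℝ) + 1 ≤ n := by exact_mod_cast h
  refine le_of_sq_le_sq ?_ (halfProd_pos s).le
  refine le_of_mul_le_mul_right (a := (4 * n : ℝ)) ?_ (by positivity)
  calc (1 / 2 * Real.exp (-(1 / 2 * Real.log n))) ^ 2 * (4 * n : ℝ)
      = Real.exp (-(1 / 2 * Real.log n)) ^ 2 * n := by ring
    _ = 1 := hE
    _ ≤ halfProd s ^ 2 * (4 * s + 1) := one_le_halfProd_sq_mul s
    _ ≤ halfProd s ^ 2 * (4 * n) :=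
        mul_le_mul_of_nonneg_left (by linarith) (sq_nonneg _)

section Paths

variable {d : ℕ} {Ω : Type*} {R : Matrix (Fin d) (Fin d) ℝ} {Y : ℕ → Ω → Fin d}

lemma visits_eq (n : ℕ) (ω : Ω) (i : Fin d) : visits Y n ω i = 1 + (visitCount Y i n ω : ℝ) := rfl

lemma one_le_visits (n : ℕ) (ω : Ω) (i : Fin d) : 1 ≤ visits Y n ω i := by
  rw [visits_eq]
  linarith [Nat.cast_nonneg (α := ℝ) (visitCount Y i n ω)]

lemma visitCount_succ {n : ℕ} (hn : d ≤ n) (ω : Ω) (i : Fin d) :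
    visitCount Y i (n + 1) ω = visitCount Y i n ω + if Y (n + 1) ω = i then 1 else 0 := by
  have h : Finset.Ioc d (n + 1) = insert (n + 1) (Finset.Ioc d n) := by
    ext m
    simp only [Finset.mem_Ioc, Finset.mem_insert]
    omega
  unfold visitCount
  rw [h, Finset.filter_insert]
  split_ifs with hy
  · rw [Finset.card_insert_of_notMem (by simp)]
  · simp

lemma visitCount_le (n : ℕ) (ω : Ω) (i : Fin d) : visitCount Y i n ω ≤ n - d :=
  (Finset.card_filter_le _ _).trans (by simp)

lemma sum_mul_visits_pos (hsymm : R.IsSymm) (hnonneg : ∀ i j, 0 ≤ R i j)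
    (hcol : ∀ j, 0 < ∑ i, R i j) (j : Fin d) (n : ℕ) (ω : Ω) :
    0 < ∑ i, R j i * visits Y n ω i := by
  refine (hcol j).trans_le (Finset.sum_le_sum fun i _ => ?_)
  rw [hsymm.apply]
  exact le_mul_of_one_le_right (hnonneg j i) (one_le_visits n ω i)

lemma hazard_nonneg (hnonneg : ∀ i j, 0 ≤ R i j) (k : Fin d) (n : ℕ) (ω : Ω) :
    0 ≤ hazard R Y k n ω :=
  div_nonneg (hnonneg _ _) <| Finset.sum_nonneg fun i _ =>
    mul_nonneg (hnonneg _ _) (zero_le_one.trans (one_le_visits n ω i))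

lemma hazard_le_one (hnonneg : ∀ i j, 0 ≤ R i j) (k : Fin d) (n : ℕ) (ω : Ω) :
    hazard R Y k n ω ≤ 1 := by
  have h0 : ∀ i, 0 ≤ R (Y n ω) i * visits Y n ω i := fun i =>
    mul_nonneg (hnonneg _ _) (zero_le_one.trans (one_le_visits n ω i))
  refine div_le_one_of_le₀ ?_ (Finset.sum_nonneg fun i _ => h0 i)
  exact (le_mul_of_one_le_right (hnonneg _ _) (one_le_visits n ω k)).trans
    (Finset.single_le_sum (fun i _ => h0 i) (Finset.mem_univ k))

lemma lyapunov_pos (k : Fin d) (n : ℕ) (ω : Ω) : 0 < lyapunov R Y k n ω :=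
  mul_pos (halfProd_pos _) (Real.exp_pos _)

lemma lyapunov_le (hnonneg : ∀ i j, 0 ≤ R i j) (k : Fin d) (n : ℕ) (ω : Ω) :
    lyapunov R Y k n ω ≤ Real.exp n := by
  have hs : ∑ m ∈ Finset.Ico d n, hazard R Y k m ω ≤ n := by
    calc ∑ m ∈ Finset.Ico d n, hazard R Y k m ω ≤ ∑ m ∈ Finset.Ico d n, (1 : ℝ) :=
          Finset.sum_le_sum fun m _ => hazard_le_one hnonneg k m ω
      _ ≤ n := by simp
  have hs0 : 0 ≤ ∑ m ∈ Finset.Ico d n, hazard R Y k m ω :=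
    Finset.sum_nonneg fun m _ => hazard_nonneg hnonneg k m ω
  calc lyapunov R Y k n ω ≤ 1 * Real.exp n :=
        mul_le_mul (halfProd_le_one _) (Real.exp_le_exp.2 (by linarith)) (Real.exp_pos _).le
          zero_le_one
    _ = Real.exp n := one_mul _

lemma lyapunov_self (k : Fin d) (ω : Ω) : lyapunov R Y k d ω = 1 := by
  simp [lyapunov, visitCount, halfProd]

lemma lyapunov_succ {n : ℕ} (hn : d ≤ n) (k : Fin d) (ω : Ω) :
    lyapunov R Y k (n + 1) ω =
      lyapunov R Y k n ω * Real.exp (1 / 2 * hazard R Y k n ω) -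
        lyapunov R Y k n ω * Real.exp (1 / 2 * hazard R Y k n ω) / (2 * visits Y n ω k) *
          (if Y (n + 1) ω = k then 1 else 0) := by
  unfold lyapunov
  rw [visitCount_succ hn, Finset.sum_Ico_succ_top hn, mul_add, Real.exp_add, visits_eq]
  split_ifs with h
  · rw [halfProd_succ, add_comm (1 : ℝ)]
    ring
  · simp only [add_zero]
    ring

section Measurability

variable {n : ℕ} {mΩ : MeasurableSpace Ω}

lemma measurable_visits (hY : ∀ m ∈ Finset.Icc d n, Measurable (Y m)) (i : Fin d) :
    Measurable fun ω => visits Y n ω i := by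
  simp only [visits, Finset.card_filter, Nat.cast_sum]
  refine measurable_const.add (Finset.measurable_sum _ fun m hm => ?_)
  have hm' : m ∈ Finset.Icc d n := Finset.Ioc_subset_Icc_self hm
  exact (measurable_of_finite fun y : Fin d => (((if y = i then 1 else 0 : ℕ)) : ℝ)).comp (hY m hm')

lemma measurable_hazard (hdn : d ≤ n) (hY : ∀ m ∈ Finset.Icc d n, Measurable (Y m)) (k : Fin d) :
    Measurable (hazard R Y k n) := by
  have hR : ∀ i, Measurable fun ω => R (Y n ω) i := fun i =>
    (measurable_of_finite fun y : Fin d => R y i).comp (hY n (Finset.right_mem_Icc.2 hdn))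
  exact (hR k).div (Finset.measurable_sum _ fun i _ => (hR i).mul (measurable_visits hY i))

lemma measurable_lyapunov (hY : ∀ m ∈ Finset.Icc d n, Measurable (Y m)) (k : Fin d) :
    Measurable (lyapunov R Y k n) := by
  have hc : Measurable (visitCount Y k n) := by
    unfold visitCount
    simp only [Finset.card_filter]
    refine Finset.measurable_sum _ fun m hm => ?_
    exact (measurable_of_finite fun y : Fin d => (if y = k then 1 else 0 : ℕ)).comp
      (hY m (Finset.Ioc_subset_Icc_self hm))
  refine ((measurable_of_countable halfProd).comp hc).mul
    (Real.measurable_exp.comp (measurable_const.mul (Finset.measurable_sum _ fun m hm => ?_)))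
  rw [Finset.mem_Ico] at hm
  exact measurable_hazard hm.1
    (fun l hl => hY l (Finset.Icc_subset_Icc_right hm.2.le hl)) k

end Measurability

lemma natFilt_le {mΩ : MeasurableSpace Ω} (hY : ∀ n, Measurable (Y n)) (n : ℕ) :
    natFilt Y n ≤ mΩ :=
  iSup₂_le fun m _ => (hY m).comap_le

lemma measurable_natFilt {n m : ℕ} (hm : m ∈ Finset.Icc d n) : Measurable[natFilt Y n] (Y m) :=
  (comap_measurable (Y m)).mono
    (le_iSup₂ (f := fun m (_ : m ∈ Finset.Icc d n) => MeasurableSpace.comap (Y m) ⊤) m hm) le_rfl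

lemma integral_mul_condExp {m mΩ : MeasurableSpace Ω} {μ : Measure Ω} [IsFiniteMeasure μ]
    (hm : m ≤ mΩ) {f g : Ω → ℝ} (hf : StronglyMeasurable[m] f) (hfg : Integrable (f * g) μ)
    (hg : Integrable g μ) : ∫ ω, f ω * (μ[g | m]) ω ∂μ = ∫ ω, f ω * g ω ∂μ := by
  calc ∫ ω, f ω * (μ[g | m]) ω ∂μ = ∫ ω, (μ[f * g | m]) ω ∂μ :=
        integral_congr_ae (condExp_mul_of_stronglyMeasurable_left hf hfg hg).symm
    _ = ∫ ω, f ω * g ω ∂μ := integral_condExp hm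

lemma integrable_lyapunov {mΩ : MeasurableSpace Ω} {μ : Measure Ω} [IsFiniteMeasure μ]
    (hnonneg : ∀ i j, 0 ≤ R i j) (hY : ∀ n, Measurable (Y n)) (k : Fin d) (n : ℕ) :
    Integrable (lyapunov R Y k n) μ :=
  .of_bound (measurable_lyapunov (fun m _ => hY m) k).aestronglyMeasurable (Real.exp n)
    (.of_forall fun ω => by
      rw [Real.norm_of_nonneg (lyapunov_pos k n ω).le]
      exact lyapunov_le hnonneg k n ω)

lemma integral_lyapunov_succ_le {mΩ : MeasurableSpace Ω} {μ : Measure Ω} [IsProbabilityMeasure μ]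
    (hnonneg : ∀ i j, 0 ≤ R i j) (hY : IsVRRW μ R Y) (k : Fin d) {n : ℕ} (hn : d ≤ n) :
    ∫ ω, lyapunov R Y k (n + 1) ω ∂μ ≤ ∫ ω, lyapunov R Y k n ω ∂μ := by
  obtain ⟨hmeas, -, hstep⟩ := hY
  set U : Ω → ℝ := fun ω => lyapunov R Y k n ω * Real.exp (1 / 2 * hazard R Y k n ω) with hU
  set W : Ω → ℝ := fun ω => U ω / (2 * visits Y n ω k) with hW
  set g : Ω → ℝ := fun ω => if Y (n + 1) ω = k then 1 else 0 with hg
  have hUm : Measurable[natFilt Y n] U :=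
    (measurable_lyapunov (fun _ => measurable_natFilt) k).mul <| Real.measurable_exp.comp <|
      (measurable_hazard hn (fun _ => measurable_natFilt) k).const_mul _
  have hWm : Measurable[natFilt Y n] W :=
    hUm.div ((measurable_visits (fun _ => measurable_natFilt) k).const_mul 2)
  have hle := natFilt_le hmeas n
  have hU0 : ∀ ω, 0 ≤ U ω := fun ω =>
    mul_nonneg (lyapunov_pos k n ω).le (Real.exp_pos _).le
  have hUb : ∀ ω, U ω ≤ Real.exp n * Real.exp 1 := fun ω =>
    mul_le_mul (lyapunov_le hnonneg k n ω)
      (Real.exp_le_exp.2 (by linarith [hazard_le_one (Y := Y) hnonneg k n ω]))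
      (Real.exp_pos _).le (Real.exp_pos _).le
  have hW0 : ∀ ω, 0 ≤ W ω := fun ω =>
    div_nonneg (hU0 ω) (by linarith [one_le_visits (Y := Y) n ω k])
  have hWU : ∀ ω, W ω ≤ U ω := fun ω =>
    div_le_self (hU0 ω) (by linarith [one_le_visits (Y := Y) n ω k])
  have hUi : Integrable U μ :=
    .of_bound (hUm.mono hle le_rfl).aestronglyMeasurable (Real.exp n * Real.exp 1)
      (.of_forall fun ω => by rw [Real.norm_of_nonneg (hU0 ω)]; exact hUb ω)
  have hgm : Measurable g :=
    (measurable_of_finite fun y : Fin d => (if y = k then 1 else 0 : ℝ)).comp (hmeas (n + 1))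
  have hg01 : ∀ ω, ‖g ω‖ ≤ 1 := fun ω => by simp only [hg]; split_ifs <;> simp
  have hgi : Integrable g μ := .of_bound hgm.aestronglyMeasurable 1 (.of_forall hg01)
  have hWi : Integrable W μ :=
    hUi.mono (hWm.mono hle le_rfl).aestronglyMeasurable (.of_forall fun ω => by
      rw [Real.norm_of_nonneg (hU0 ω), Real.norm_of_nonneg (hW0 ω)]; exact hWU ω)
  have hWg : Integrable (W * g) μ :=
    hWi.mul_bdd (c := 1) hgm.aestronglyMeasurable (.of_forall hg01)
  have hcond : ∫ ω, W ω * g ω ∂μ = ∫ ω, U ω * (1 / 2 * hazard R Y k n ω) ∂μ := by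
    rw [← integral_mul_condExp hle hWm.stronglyMeasurable hWg hgi]
    refine integral_congr_ae ?_
    filter_upwards [hstep n hn k] with ω hω
    have hv : visits Y n ω k ≠ 0 := by linarith [one_le_visits (Y := Y) n ω k]
    rw [hω]
    simp only [hW, hazard]
    field_simp
  have hUh : Integrable (fun ω => U ω * (1 / 2 * hazard R Y k n ω)) μ := by
    refine hUi.mul_bdd (c := 1) ((measurable_hazard hn (fun m _ => hmeas m) k).const_mul
      _).aestronglyMeasurable (.of_forall fun ω => ?_)
    have h0 := hazard_nonneg (Y := Y) hnonneg k n ω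
    have h1 := hazard_le_one (Y := Y) hnonneg k n ω
    rw [Real.norm_of_nonneg (by linarith)]
    linarith
  calc ∫ ω, lyapunov R Y k (n + 1) ω ∂μ = ∫ ω, (U ω - W ω * g ω) ∂μ :=
        integral_congr_ae (.of_forall fun ω => lyapunov_succ hn k ω)
    _ = ∫ ω, U ω ∂μ - ∫ ω, W ω * g ω ∂μ := integral_sub hUi hWg
    _ = ∫ ω, (U ω - U ω * (1 / 2 * hazard R Y k n ω)) ∂μ := by
        rw [hcond, integral_sub hUi hUh]
    _ ≤ ∫ ω, lyapunov R Y k n ω ∂μ := by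
        refine integral_mono (hUi.sub hUh) (integrable_lyapunov hnonneg hmeas k n) fun ω => ?_
        set x := 1 / 2 * hazard R Y k n ω with hx
        have hexp : Real.exp x * (1 - x) ≤ 1 := by
          calc Real.exp x * (1 - x) ≤ Real.exp x * Real.exp (-x) :=
                mul_le_mul_of_nonneg_left (Real.one_sub_le_exp_neg x) (Real.exp_pos _).le
            _ = 1 := by rw [← Real.exp_add, add_neg_cancel, Real.exp_zero]
        calc U ω - U ω * x = lyapunov R Y k n ω * (Real.exp x * (1 - x)) := by
              simp only [hU]; ring
          _ ≤ lyapunov R Y k n ω * 1 := mul_le_mul_of_nonneg_left hexp (lyapunov_pos k n ω).le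
          _ = lyapunov R Y k n ω := mul_one _

lemma integral_lyapunov_le_one {mΩ : MeasurableSpace Ω} {μ : Measure Ω} [IsProbabilityMeasure μ]
    (hnonneg : ∀ i j, 0 ≤ R i j) (hY : IsVRRW μ R Y) (k : Fin d) {n : ℕ} (hn : d ≤ n) :
    ∫ ω, lyapunov R Y k n ω ∂μ ≤ 1 := by
  induction n, hn using Nat.le_induction with
  | base => simp [lyapunov_self]
  | succ n hn ih => exact (integral_lyapunov_succ_le hnonneg hY k hn).trans ih

/-- By Fatou's lemma, the Lyapunov process almost surely does not tend to infinity. -/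
lemma ae_not_tendsto_lyapunov {mΩ : MeasurableSpace Ω} {μ : Measure Ω} [IsProbabilityMeasure μ]
    (hnonneg : ∀ i j, 0 ≤ R i j) (hY : IsVRRW μ R Y) (k : Fin d) :
    ∀ᵐ ω ∂μ, ¬ Tendsto (fun n => lyapunov R Y k n ω) atTop atTop := by
  have hm : ∀ n, Measurable fun ω => ENNReal.ofReal (lyapunov R Y k n ω) := fun n =>
    (measurable_lyapunov (fun m _ => hY.1 m) k).ennreal_ofReal
  have hfatou : ∫⁻ ω, liminf (fun n => ENNReal.ofReal (lyapunov R Y k n ω)) atTop ∂μ ≤ 1 := by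
    refine (lintegral_liminf_le hm).trans ?_
    refine liminf_le_of_frequently_le' (Eventually.frequently ?_)
    filter_upwards [eventually_ge_atTop d] with n hn
    rw [← ofReal_integral_eq_lintegral_ofReal (integrable_lyapunov hnonneg hY.1 k n)
      (.of_forall fun ω => (lyapunov_pos k n ω).le)]
    exact ENNReal.ofReal_le_one.2 (integral_lyapunov_le_one hnonneg hY k hn)
  filter_upwards [ae_lt_top (.liminf hm) (hfatou.trans_lt ENNReal.one_lt_top).ne] with ω hω htend
  exact hω.ne (ENNReal.tendsto_ofReal_atTop.comp htend).liminf_eq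

lemma sum_mul_visits_eq {n : ℕ} (hn : n ≠ 0) (j : Fin d) (ω : Ω) :
    ∑ i, R j i * visits Y n ω i = n * Nvec R (occup Y n ω) j := by
  have hn' : (n : ℝ) ≠ 0 := by exact_mod_cast hn
  rw [Nvec, Finset.mul_sum]
  refine Finset.sum_congr rfl fun i _ => ?_
  simp only [occup]
  field_simp

lemma sum_mul_occup_succ {n : ℕ} (hn : d ≤ n) (hn0 : n ≠ 0) (a : Fin d → ℝ) (ω : Ω) :
    a (Y (n + 1) ω) / ((n : ℝ) + 1) =
      ∑ i, a i * occup Y (n + 1) ω i - ∑ i, a i * occup Y n ω i +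
        (∑ i, a i * occup Y n ω i) / ((n : ℝ) + 1) := by
  have hn' : (n : ℝ) ≠ 0 := by exact_mod_cast hn0
  have hn1 : (n : ℝ) + 1 ≠ 0 := by positivity
  have h : a (Y (n + 1) ω) = ∑ i, a i * if Y (n + 1) ω = i then 1 else 0 := by simp
  rw [h, Finset.sum_div, Finset.sum_div, ← Finset.sum_sub_distrib, ← Finset.sum_add_distrib]
  refine Finset.sum_congr rfl fun i _ => ?_
  simp only [occup, visits_eq, visitCount_succ hn]
  push_cast
  field_simp
  ring

/-- If `V(n) → p` and state `k` is attracted to the support of `p` at rate larger than the rate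
on the support, then the accumulated hazard exceeds `log n` by an unbounded amount. -/
lemma tendsto_sum_hazard_sub_log (hd : d ≠ 0) (hsymm : R.IsSymm) (hnonneg : ∀ i j, 0 ≤ R i j)
    (hcol : ∀ j, 0 < ∑ i, R i j) {p : Fin d → ℝ} (hp : ∀ i, 0 ≤ p i) {H : ℝ} (hH : 0 ≤ H)
    (hsupp : ∀ i, 0 < p i → Nvec R p i = H) {k : Fin d} (hk : H < Nvec R p k) {ω : Ω}
    (hω : Tendsto (fun n => occup Y n ω) atTop (nhds p)) :
    Tendsto (fun n : ℕ => ∑ m ∈ Finset.Ico d n, hazard R Y k m ω - Real.log n) atTop atTop := by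
  obtain ⟨H', hHH', hH'k⟩ := exists_between hk
  obtain ⟨N', hHN', hN'k⟩ := exists_between hH'k
  have hH' : 0 < H' := hH.trans_lt hHH'
  have hcoord : ∀ i, Tendsto (fun n => occup Y n ω i) atTop (nhds (p i)) := tendsto_pi_nhds.1 hω
  set a : Fin d → ℝ := fun i => if 0 < p i then R i k else 0 with ha
  have ha0 : ∀ i, 0 ≤ a i := fun i => by simp only [ha]; split_ifs; exacts [hnonneg i k, le_rfl]
  set b : ℕ → ℝ := fun n => ∑ i, a i * occup Y n ω i with hb
  have hb0 : ∀ n, 0 ≤ b n := fun n => Finset.sum_nonneg fun i _ =>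
    mul_nonneg (ha0 i) (div_nonneg (zero_le_one.trans (one_le_visits n ω i)) n.cast_nonneg)
  have hbN : Tendsto b atTop (nhds (Nvec R p k)) := by
    have h : Nvec R p k = ∑ i, a i * p i := by
      refine Finset.sum_congr rfl fun i _ => ?_
      simp only [ha]
      split_ifs with hi
      · rw [hsymm.apply]
      · rw [le_antisymm (not_lt.1 hi) (hp i)]; simp
    rw [h]
    exact tendsto_finsetSum _ fun i _ => (hcoord i).const_mul _
  have hNv : ∀ᶠ n in atTop, ∀ i, 0 < p i → Nvec R (occup Y n ω) i < H' := by
    refine eventually_all.2 fun i => ?_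
    by_cases hi : 0 < p i
    · have h : Tendsto (fun n => Nvec R (occup Y n ω) i) atTop (nhds (Nvec R p i)) :=
        tendsto_finsetSum _ fun j _ => (hcoord j).const_mul _
      filter_upwards [h.eventually_lt_const ((hsupp i hi).trans_lt hHH')] with n hn _ using hn
    · exact .of_forall fun n h => absurd h hi
  obtain ⟨n₀, hn₀⟩ := eventually_atTop.1
    (hNv.and ((hbN.eventually_const_lt hN'k).and (eventually_ge_atTop d)))
  have hhaz : ∀ n, n₀ ≤ n → a (Y n ω) / n ≤ H' * hazard R Y k n ω := by
    intro n hn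
    have hnd : d ≤ n := (hn₀ n hn).2.2
    have hn0 : n ≠ 0 := by omega
    have hnpos : (0 : ℝ) < n := by exact_mod_cast Nat.pos_of_ne_zero hn0
    by_cases hi : 0 < p (Y n ω)
    · have hT := sum_mul_visits_pos (Y := Y) hsymm hnonneg hcol (Y n ω) n ω
      have hlt := (hn₀ n hn).1 _ hi
      simp only [ha, hi, if_true, hazard]
      rw [← mul_div_assoc, div_le_div_iff₀ hnpos hT, sum_mul_visits_eq hn0]
      have := mul_le_mul_of_nonneg_left hlt.le (mul_nonneg (hnonneg (Y n ω) k) hnpos.le)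
      linarith
    · simp only [ha, hi, if_false, zero_div]
      exact mul_nonneg hH'.le (hazard_nonneg hnonneg k n ω)
  set D : ℕ → ℝ := fun n =>
    H' * ∑ m ∈ Finset.Ico d (n + 1), hazard R Y k m ω - b n - N' * Real.log ((n : ℝ) + 1) with hD
  have hN' : 0 < N' := hH'.trans hHN'
  have hDmono : ∀ n, n₀ ≤ n → D n₀ ≤ D n := by
    intro n hn
    induction n, hn using Nat.le_induction with
    | base => exact le_rfl
    | succ n hn ih =>
      refine ih.trans ?_
      have hnd : d ≤ n := (hn₀ n hn).2.2
      have hid := sum_mul_occup_succ (Y := Y) hnd (by omega) a ω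
      have hz := hhaz (n + 1) (by omega)
      push_cast at hz
      have hn1 : (0 : ℝ) < (n : ℝ) + 1 := by positivity
      have hbn : N' / ((n : ℝ) + 1) ≤ b n / ((n : ℝ) + 1) :=
        div_le_div_of_nonneg_right (hn₀ n hn).2.1.le hn1.le
      have hlog : Real.log ((n : ℝ) + 1 + 1) - Real.log ((n : ℝ) + 1) ≤ 1 / ((n : ℝ) + 1) := by
        rw [← Real.log_div (by positivity) hn1.ne']
        refine (Real.log_le_sub_one_of_pos (by positivity)).trans (le_of_eq ?_)
        field_simp
        ring
      have hlog' := mul_le_mul_of_nonneg_left hlog hN'.le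
      rw [mul_one_div] at hlog'
      simp only [hD]
      rw [Finset.sum_Ico_succ_top (show d ≤ n + 1 by omega)]
      push_cast
      change _ = b (n + 1) - b n + b n / ((n : ℝ) + 1) at hid
      linarith
  rw [← tendsto_add_atTop_iff_nat 1]
  have hlim : Tendsto (fun n : ℕ => D n₀ / H' + (N' / H' - 1) * Real.log ((n + 1 : ℕ) : ℝ))
      atTop atTop := by
    refine tendsto_atTop_add_const_left _ _ (Tendsto.const_mul_atTop ?_ ?_)
    · rw [sub_pos, one_lt_div hH']
      exact hHN'
    · exact Real.tendsto_log_atTop.comp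
        (tendsto_natCast_atTop_atTop.comp (tendsto_add_atTop_nat 1))
  refine tendsto_atTop_mono' _ ?_ hlim
  filter_upwards [eventually_ge_atTop n₀] with n hn
  have h1 := hDmono n hn
  have h2 : D n₀ + N' * Real.log ((n : ℝ) + 1) ≤
      H' * ∑ m ∈ Finset.Ico d (n + 1), hazard R Y k m ω := by
    have h3 := hb0 n
    have h4 : D n = H' * ∑ m ∈ Finset.Ico d (n + 1), hazard R Y k m ω - b n -
      N' * Real.log ((n : ℝ) + 1) := rfl
    linarith
  rw [← div_le_iff₀' hH', add_div, mul_div_right_comm] at h2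
  push_cast
  linarith

lemma le_lyapunov (hd : d ≠ 0) (k : Fin d) {n : ℕ} (hn : d ≤ n) (ω : Ω) :
    1 / 2 * Real.exp (1 / 2 * (∑ m ∈ Finset.Ico d n, hazard R Y k m ω - Real.log n)) ≤
      lyapunov R Y k n ω := by
  have hc := visitCount_le (Y := Y) n ω k
  rw [mul_sub, sub_eq_neg_add, Real.exp_add, ← mul_assoc]
  exact mul_le_mul_of_nonneg_right (exp_neg_half_log_le_halfProd (by omega)) (Real.exp_pos _).le

end Paths

lemma Nvec_eq_Hfun_of_pos {d : ℕ} {R : Matrix (Fin d) (Fin d) ℝ} {p : Fin d → ℝ}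
    (hH : 0 < Hfun R p) (hcrit : piVec R p = p) {i : Fin d} (hi : 0 < p i) :
    Nvec R p i = Hfun R p := by
  have h : p i * Nvec R p i / Hfun R p = p i := congrFun hcrit i
  rw [div_eq_iff hH.ne'] at h
  exact mul_left_cancel₀ hi.ne' h

end VRRW

/-- If `p` is a critical point in a proper face of the simplex which is a
linear non-maximum, then `P(V(n) → p) = 0`. -/
theorem stmt2 {d : ℕ} (hd : 2 ≤ d) (R : Matrix (Fin d) (Fin d) ℝ)
    (hsymm : R.IsSymm) (hnonneg : ∀ i j, 0 ≤ R i j) (hcol : ∀ j, 0 < ∑ i, R i j)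
    (p : Fin d → ℝ) (hp : p ∈ simplex d) (hH : 0 < Hfun R p)
    (hcrit : piVec R p = p)
    (hlnm : ∃ k j : Fin d, p k = 0 ∧ 0 < p j ∧ Nvec R p j < Nvec R p k)
    {Ω : Type} [MeasurableSpace Ω] (μ : Measure Ω) [IsProbabilityMeasure μ]
    (Y : ℕ → Ω → Fin d) (hY : IsVRRW μ R Y) :
    μ {ω | Tendsto (fun n => occup Y n ω) atTop (nhds p)} = 0 := by
  obtain ⟨k, j, -, hj, hjk⟩ := hlnm
  rw [Nvec_eq_Hfun_of_pos hH hcrit hj] at hjk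
  refine measure_mono_null (fun ω hω => ?_) (ae_not_tendsto_lyapunov hnonneg hY k)
  have hlim := tendsto_sum_hazard_sub_log (by omega) hsymm hnonneg hcol hp.1 hH.le
    (fun i hi => Nvec_eq_Hfun_of_pos hH hcrit hi) hjk hω
  refine not_not.2 (tendsto_atTop_mono' _ ?_ <|
    (Real.tendsto_exp_atTop.comp (hlim.const_mul_atTop one_half_pos)).const_mul_atTop one_half_pos)
  filter_upwards [eventually_ge_atTop d] with n hn
  exact le_lyapunov (by omega) k hn ω
end

section
/- For every v ∈ Δ with H(v) > 0, the directional derivative of H at v in the direction π(v) − v is nonnegative; explicitly, Σ_i N_i(v) (π_i(v) − v_i) ≥ 0 (the directional derivative equals twice this sum). -/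
open MeasureTheory Filter Finset

open VRRW

/-- The sum equals the variance of `N(v)` under `v`, divided by `H(v)`. -/
theorem sum_Nvec_mul_piVec_sub {d : ℕ} (R : Matrix (Fin d) (Fin d) ℝ) {v : Fin d → ℝ}
    (hv : ∑ i, v i = 1) (hH : Hfun R v ≠ 0) :
    ∑ i, Nvec R v i * (piVec R v i - v i) =
      ∑ i, v i * (Nvec R v i - Hfun R v) ^ 2 / Hfun R v := by
  have hN : ∑ i, v i * Nvec R v i = Hfun R v := by
    simp only [Nvec, Hfun, Finset.mul_sum]
    exact Finset.sum_congr rfl fun i _ => Finset.sum_congr rfl fun j _ => by ring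
  have hterm : ∀ i, Nvec R v i * (piVec R v i - v i) =
      v i * (Nvec R v i - Hfun R v) ^ 2 / Hfun R v + v i * Nvec R v i - Hfun R v * v i := by
    intro i
    simp only [piVec]
    field_simp
    ring
  simp only [hterm, Finset.sum_sub_distrib, Finset.sum_add_distrib, ← Finset.mul_sum, hN, hv]
  ring

/-- For `v ∈ Δ` with `H(v) > 0`, the directional derivative of `H` at `v`
in the direction `π(v) − v` is nonnegative: `Σ_i N_i(v) (π_i(v) − v_i) ≥ 0`. -/
theorem stmt5 {d : ℕ} (hd : 2 ≤ d) (R : Matrix (Fin d) (Fin d) ℝ)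
    (hsymm : R.IsSymm) (hnonneg : ∀ i j, 0 ≤ R i j) (hcol : ∀ j, 0 < ∑ i, R i j) :
    ∀ v ∈ simplex d, 0 < Hfun R v →
      0 ≤ ∑ i, Nvec R v i * (piVec R v i - v i) := by
  intro v hv hH
  rw [sum_Nvec_mul_piVec_sub R hv.2 hH.ne']
  exact Finset.sum_nonneg fun i _ =>
    div_nonneg (mul_nonneg (hv.1 i) (sq_nonneg _)) hH.le
end

section
/- The critical set C has finitely many connected components (in the subspace topology of ℝ^d); each connected component of C is closed, and H is constant on each connected component of C. -/
open MeasureTheory Filter Finset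

open VRRW

namespace VRRW

/-- The image of a set under a function that factors, on that set, through a function with
values in a finite type is finite. -/
theorem finite_image_of_factors {α β γ : Type*} [Finite γ] {s : Set α} (f : α → β) (g : α → γ)
    (h : ∀ x ∈ s, ∀ y ∈ s, g x = g y → f x = f y) : (f '' s).Finite := by
  have hg : (g '' s).Finite := Set.toFinite _
  obtain ⟨t, hts, hgt⟩ := (Set.surjOn_image g s).exists_bijOn_subset
  have ht : t.Finite := hgt.finite_iff_finite.mpr hg
  refine (ht.image f).subset ?_
  rintro _ ⟨x, hx, rfl⟩
  obtain ⟨y, hy, hxy⟩ := hgt.surjOn (Set.mem_image_of_mem g hx)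
  exact ⟨y, hy, h y (hts hy) x hx hxy⟩

theorem isClosed_connectedComponentIn {X : Type*} [TopologicalSpace X] {s : Set X} {x : X}
    (hs : IsClosed s) (hx : x ∈ s) : IsClosed (connectedComponentIn s x) :=
  isClosed_of_closure_subset <|
    isPreconnected_connectedComponentIn.closure.subset_connectedComponentIn
      (subset_closure (mem_connectedComponentIn hx))
      (closure_minimal (connectedComponentIn_subset s x) hs)

variable {d : ℕ} {R : Matrix (Fin d) (Fin d) ℝ} {v w : Fin d → ℝ}

theorem Hfun_eq_sum (R : Matrix (Fin d) (Fin d) ℝ) (v : Fin d → ℝ) :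
    Hfun R v = ∑ i, v i * Nvec R v i := by
  simp only [Hfun, Nvec, Finset.mul_sum]
  exact Finset.sum_congr rfl fun i _ => Finset.sum_congr rfl fun j _ => by ring

theorem sum_mul_Nvec_comm (hR : R.IsSymm) (v w : Fin d → ℝ) :
    ∑ i, v i * Nvec R w i = ∑ i, w i * Nvec R v i := by
  simp only [Nvec, Finset.mul_sum]
  rw [Finset.sum_comm]
  refine Finset.sum_congr rfl fun i _ => Finset.sum_congr rfl fun j _ => ?_
  rw [hR.apply i j]
  ring

theorem mem_critSet_iff : v ∈ critSet R ↔
    v ∈ simplex d ∧ 0 < Hfun R v ∧ ∀ i, v i * Nvec R v i = v i * Hfun R v := by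
  refine and_congr_right fun _ => and_congr_right fun hH => ?_
  simp only [funext_iff, piVec, div_eq_iff hH.ne']

theorem Nvec_eq_of_mem_critSet (hv : v ∈ critSet R) {i : Fin d} (hi : v i ≠ 0) :
    Nvec R v i = Hfun R v :=
  mul_left_cancel₀ hi ((mem_critSet_iff.1 hv).2.2 i)

theorem sum_mul_Nvec_of_support_subset (hv : v ∈ simplex d) (hw : w ∈ critSet R)
    (hvw : Function.support v ⊆ Function.support w) :
    ∑ i, v i * Nvec R w i = Hfun R w := by
  have h : ∀ i, v i * Nvec R w i = v i * Hfun R w := fun i => by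
    by_cases hi : v i = 0
    · simp [hi]
    · rw [Nvec_eq_of_mem_critSet hw (hvw hi)]
  simp only [h, ← Finset.sum_mul, hv.2, one_mul]

theorem Hfun_eq_of_support_eq (hR : R.IsSymm) (hv : v ∈ critSet R) (hw : w ∈ critSet R)
    (hvw : Function.support v = Function.support w) : Hfun R v = Hfun R w := by
  rw [← sum_mul_Nvec_of_support_subset hv.1 hw hvw.subset, sum_mul_Nvec_comm hR,
    sum_mul_Nvec_of_support_subset hw.1 hv hvw.superset]

theorem segment_subset_critSet (hR : R.IsSymm) (hv : v ∈ critSet R) (hw : w ∈ critSet R)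
    (hvw : Function.support v = Function.support w) : segment ℝ v w ⊆ critSet R := by
  rintro _ ⟨a, b, ha, hb, hab, rfl⟩
  have hH := Hfun_eq_of_support_eq hR hv hw hvw
  have hmem : a • v + b • w ∈ simplex d := by
    refine ⟨fun i => ?_, ?_⟩
    · have h₁ := hv.1.1 i
      have h₂ := hw.1.1 i
      simp only [Pi.add_apply, Pi.smul_apply, smul_eq_mul]
      positivity
    · simp [Finset.sum_add_distrib, ← Finset.mul_sum, hv.1.2, hw.1.2, hab]
  have hN : ∀ i, (a • v + b • w) i * Nvec R (a • v + b • w) i =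
      (a • v + b • w) i * Hfun R v := fun i => by
    have hlin : Nvec R (a • v + b • w) i = a * Nvec R v i + b * Nvec R w i := by
      simp only [Nvec, Finset.mul_sum, ← Finset.sum_add_distrib, Pi.add_apply, Pi.smul_apply,
        smul_eq_mul]
      exact Finset.sum_congr rfl fun j _ => by ring
    by_cases hi : v i = 0
    · have hi' : w i = 0 := by
        by_contra h
        exact (hvw.superset h) hi
      simp [hi, hi']
    · rw [hlin, Nvec_eq_of_mem_critSet hv hi, Nvec_eq_of_mem_critSet hw (hvw.subset hi), ← hH,
        ← add_mul, hab, one_mul]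
  have hHu : Hfun R (a • v + b • w) = Hfun R v := by
    rw [Hfun_eq_sum R (a • v + b • w), Finset.sum_congr rfl fun i _ => hN i, ← Finset.sum_mul,
      hmem.2, one_mul]
  exact mem_critSet_iff.2 ⟨hmem, hHu ▸ hv.2.1, hHu ▸ hN⟩

theorem connectedComponentIn_critSet_eq (hR : R.IsSymm) (hv : v ∈ critSet R)
    (hw : w ∈ critSet R) (hvw : Function.support v = Function.support w) :
    connectedComponentIn (critSet R) v = connectedComponentIn (critSet R) w :=
  connectedComponentIn_eq ((convex_segment v w).isPreconnected.subset_connectedComponentIn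
    (left_mem_segment ℝ v w) (segment_subset_critSet hR hv hw hvw) (right_mem_segment ℝ v w))

theorem finite_image_Hfun_critSet (hR : R.IsSymm) : (Hfun R '' critSet R).Finite :=
  finite_image_of_factors (Hfun R) Function.support
    fun _ hv _ hw hvw => Hfun_eq_of_support_eq hR hv hw hvw

theorem continuous_Nvec (R : Matrix (Fin d) (Fin d) ℝ) (i : Fin d) :
    Continuous fun v => Nvec R v i := by
  unfold Nvec
  fun_prop

theorem continuous_Hfun (R : Matrix (Fin d) (Fin d) ℝ) : Continuous (Hfun R) := by
  unfold Hfun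
  fun_prop

theorem isClosed_simplex (d : ℕ) : IsClosed (simplex d) := by
  simp only [simplex, Set.ofPred_and, Set.ofPred_forall]
  exact (isClosed_iInter fun i => isClosed_le continuous_const (continuous_apply i)).inter
    (isClosed_eq (by fun_prop) continuous_const)

theorem isClosed_critSet (hR : R.IsSymm) : IsClosed (critSet R) := by
  have h : critSet R = simplex d ∩ (Hfun R ⁻¹' (Hfun R '' critSet R) ∩
      ⋂ i, {v | v i * Nvec R v i = v i * Hfun R v}) := by
    ext v
    simp only [Set.mem_inter_iff, Set.mem_preimage, Set.mem_iInter, Set.mem_ofPred_eq]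
    refine ⟨fun hv => ⟨hv.1, ⟨v, hv, rfl⟩, (mem_critSet_iff.1 hv).2.2⟩, ?_⟩
    rintro ⟨hv, ⟨w, hw, hwv⟩, hN⟩
    exact mem_critSet_iff.2 ⟨hv, hwv ▸ hw.2.1, hN⟩
  rw [h]
  exact (isClosed_simplex d).inter
    (((finite_image_Hfun_critSet hR).isClosed.preimage (continuous_Hfun R)).inter
      (isClosed_iInter fun i => isClosed_eq ((continuous_apply i).mul (continuous_Nvec R i))
        ((continuous_apply i).mul (continuous_Hfun R))))

end VRRW

/-- The critical set `C` has finitely many connected components, each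
connected component is closed, and `H` is constant on each connected component. -/
theorem stmt7 {d : ℕ} (hd : 2 ≤ d) (R : Matrix (Fin d) (Fin d) ℝ)
    (hsymm : R.IsSymm) (hnonneg : ∀ i j, 0 ≤ R i j) (hcol : ∀ j, 0 < ∑ i, R i j) :
    {A : Set (Fin d → ℝ) | ∃ x ∈ critSet R, A = connectedComponentIn (critSet R) x}.Finite ∧
    (∀ x ∈ critSet R, IsClosed (connectedComponentIn (critSet R) x)) ∧
    (∀ x ∈ critSet R, ∀ y ∈ connectedComponentIn (critSet R) x, Hfun R y = Hfun R x) := by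
  refine ⟨?_, fun x hx => isClosed_connectedComponentIn (isClosed_critSet hsymm) hx, fun x hx y hy => ?_⟩
  · refine (finite_image_of_factors (s := critSet R) (connectedComponentIn (critSet R))
      Function.support fun _ hv _ hw => connectedComponentIn_critSet_eq hsymm hv hw).subset ?_
    rintro _ ⟨x, hx, rfl⟩
    exact ⟨x, hx, rfl⟩
  · have himage : (Hfun R '' connectedComponentIn (critSet R) x).Subsingleton :=
      (finite_image_Hfun_critSet hsymm).countable.isTotallyDisconnected _
        (Set.image_mono (connectedComponentIn_subset _ _))
        (isPreconnected_connectedComponentIn.image _ (continuous_Hfun R).continuousOn)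
    exact himage ⟨y, hy, rfl⟩ ⟨x, mem_connectedComponentIn hx, rfl⟩
end

section
/- If every principal submatrix of R (the submatrix with rows and columns indexed by any nonempty subset of {1,…,d}) is invertible, then the critical set C is finite and has at most 2^d − 1 elements. -/
open MeasureTheory Filter Finset

open VRRW

/-- At a critical point, `Nvec` is constant, equal to `Hfun`, on the support. -/
theorem VRRW.Nvec_eq_Hfun_of_mem_critSet {d : ℕ} {R : Matrix (Fin d) (Fin d) ℝ}
    {v : Fin d → ℝ} (hv : v ∈ critSet R) {i : Fin d} (hi : v i ≠ 0) :
    Nvec R v i = Hfun R v := by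
  obtain ⟨-, hH, hpi⟩ := hv
  have h := congrFun hpi i
  rw [piVec, div_eq_iff hH.ne'] at h
  exact mul_left_cancel₀ hi h

/-- A vector supported in `s` and annihilated by the rows in `s` of a matrix whose principal
submatrix on `s` is invertible vanishes. -/
theorem Matrix.eq_zero_of_isUnit_det_submatrix {n K : Type*} [Fintype n] [DecidableEq n] [Field K]
    (A : Matrix n n K) (s : Finset n)
    (hs : IsUnit (A.submatrix (fun i : s => (i : n)) (fun j : s => (j : n))).det)
    {u : n → K} (hu : ∀ i ∉ s, u i = 0) (hAu : ∀ i ∈ s, ∑ j, A i j * u j = 0) : u = 0 := by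
  have hker : (A.submatrix (fun i : s => (i : n)) (fun j : s => (j : n))).mulVec
      (fun j : s => u j) = 0 := by
    funext i
    have hsum : ∑ j ∈ s, A i j * u j = ∑ j, A i j * u j :=
      Finset.sum_subset (Finset.subset_univ s) fun j _ hj => by rw [hu j hj, mul_zero]
    simp only [Matrix.mulVec, dotProduct, Matrix.submatrix_apply, Pi.zero_apply]
    rw [Finset.sum_coe_sort s (fun j => A i j * u j), hsum, hAu i i.2]
  have hzero := Matrix.eq_zero_of_mulVec_eq_zero hs.ne_zero hker
  funext i
  by_cases hi : i ∈ s
  · exact congrFun hzero ⟨i, hi⟩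
  · exact hu i hi

/-- The support of a vector in the simplex is nonempty. -/
theorem VRRW.support_nonempty_of_mem_simplex {d : ℕ} {v : Fin d → ℝ} (hv : v ∈ simplex d) :
    (Finset.univ.filter fun i => v i ≠ 0).Nonempty := by
  obtain ⟨i, -, hi⟩ := Finset.exists_ne_zero_of_sum_ne_zero (hv.2.trans_ne one_ne_zero)
  exact ⟨i, by simpa using hi⟩

/-- Critical points are determined by their support. -/
theorem VRRW.injOn_support_critSet {d : ℕ} {R : Matrix (Fin d) (Fin d) ℝ}
    (hminor : ∀ s : Finset (Fin d), s.Nonempty →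
      IsUnit (R.submatrix (fun i : s => (i : Fin d)) (fun j : s => (j : Fin d))).det) :
    Set.InjOn (fun v : Fin d → ℝ => Finset.univ.filter fun i => v i ≠ 0) (critSet R) := by
  intro v hv w hw hvw
  have hiff : ∀ i, v i ≠ 0 ↔ w i ≠ 0 := fun i => by
    simpa using Finset.ext_iff.mp hvw i
  have hu : (fun i => Hfun R w * v i - Hfun R v * w i) = 0 := by
    refine R.eq_zero_of_isUnit_det_submatrix _
      (hminor _ (support_nonempty_of_mem_simplex hv.1)) (fun i hi => ?_) (fun i hi => ?_)
    · have hvi : v i = 0 := by simpa using hi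
      have hwi : w i = 0 := by_contra fun h => (hiff i).mpr h hvi
      rw [hvi, hwi, mul_zero, mul_zero, sub_zero]
    · have hvi : v i ≠ 0 := by simpa using hi
      calc ∑ j, R i j * (Hfun R w * v j - Hfun R v * w j)
          = Hfun R w * Nvec R v i - Hfun R v * Nvec R w i := by
            rw [Nvec, Nvec, Finset.mul_sum, Finset.mul_sum, ← Finset.sum_sub_distrib]
            exact Finset.sum_congr rfl fun j _ => by ring
        _ = 0 := by
            rw [Nvec_eq_Hfun_of_mem_critSet hv hvi,
              Nvec_eq_Hfun_of_mem_critSet hw ((hiff i).mp hvi)]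
            ring
  have hprop : ∀ i, Hfun R w * v i = Hfun R v * w i := fun i => sub_eq_zero.mp (congrFun hu i)
  have hH : Hfun R w = Hfun R v := by
    have hsum := Finset.sum_congr (rfl : (Finset.univ : Finset (Fin d)) = _) fun i _ => hprop i
    rwa [← Finset.mul_sum, ← Finset.mul_sum, hv.1.2, hw.1.2, mul_one, mul_one] at hsum
  funext i
  exact mul_left_cancel₀ hw.2.1.ne' ((hprop i).trans (by rw [hH]))

/-- If all principal submatrices of `R` are invertible then the critical
set `C` is finite, with at most `2^d − 1` elements. -/
theorem stmt8 {d : ℕ} (hd : 2 ≤ d) (R : Matrix (Fin d) (Fin d) ℝ)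
    (hsymm : R.IsSymm) (hnonneg : ∀ i j, 0 ≤ R i j) (hcol : ∀ j, 0 < ∑ i, R i j)
    (hminor : ∀ s : Finset (Fin d), s.Nonempty →
      IsUnit (R.submatrix (fun i : s => (i : Fin d)) (fun j : s => (j : Fin d))).det) :
    (critSet R).Finite ∧ (critSet R).ncard ≤ 2 ^ d - 1 := by
  have hinj := injOn_support_critSet hminor
  have hmaps : Set.MapsTo (fun v : Fin d → ℝ => Finset.univ.filter fun i => v i ≠ 0)
      (critSet R) ((Finset.univ.erase ∅ : Finset (Finset (Fin d))) : Set (Finset (Fin d))) :=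
    fun v hv => by
      simpa only [Finset.coe_erase, Finset.coe_univ, Set.mem_sdiff, Set.mem_univ, true_and,
        Set.mem_singleton_iff] using (support_nonempty_of_mem_simplex hv.1).ne_empty
  refine ⟨Set.Finite.of_injOn hmaps hinj (Finset.finite_toSet _), ?_⟩
  refine (Set.ncard_le_ncard_of_injOn _ hmaps hinj (Finset.finite_toSet _)).trans_eq ?_
  rw [Set.ncard_coe_finset, Finset.card_erase_of_mem (Finset.mem_univ _), Finset.card_univ,
    Fintype.card_finset, Fintype.card_fin]
end
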